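/- Let (δ,σ) be a modular pair in involution on H and let D_H be a left H-category. Let ^σk_δ denote k with right H-action α·h = δ(h)α and left H-coaction α ↦ σ⊗α, which is a right-left SAYD module over H. Then the assignment φ ↦ T^φ, where T^φ_X(f) = φ(1⊗f) for f ∈ Hom_{D_H}(X,X), is a bijection from Z⁰_H(D_H,^σk_δ) = {φ ∈ C⁰_H(D_H,^σk_δ) : δ₀(φ) = δ₁(φ)} onto the set of δ-invariant σ-traces on D_H. -/

import Mathlib

open TensorProduct DirectSum

noncomputable section

namespace HopfCyclicStmt

variable (k H : Type) [Field k] [CharZero k] [Ring H] [HopfAlgebra k H]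

/-! ### Left `H`-categories -/

/-- A left `H`-category: a small `k`-linear category whose Hom-spaces are left `H`-modules,
such that `h • id_X = ε(h) • id_X` and `h • (g ∘ f) = (h₁ • g) ∘ (h₂ • f)` (the latter stated
by quantifying over all finite representations of `comul h` as a sum of pure tensors). -/
structure HCategory (k H : Type) [Field k] [Ring H] [HopfAlgebra k H] where
  Obj : Type
  Hom : Obj → Obj → Type
  [homAddCommGroup : ∀ X Y, AddCommGroup (Hom X Y)]
  [homModule : ∀ X Y, Module k (Hom X Y)]
  id : (X : Obj) → Hom X X
  comp : {X Y Z : Obj} → Hom Y Z →ₗ[k] Hom X Y →ₗ[k] Hom X Z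
  id_comp : ∀ {X Y : Obj} (f : Hom X Y), comp (id Y) f = f
  comp_id : ∀ {X Y : Obj} (f : Hom X Y), comp f (id X) = f
  comp_assoc : ∀ {W X Y Z : Obj} (h : Hom Y Z) (g : Hom X Y) (f : Hom W X),
      comp h (comp g f) = comp (comp h g) f
  act : (X Y : Obj) → H →ₗ[k] Hom X Y →ₗ[k] Hom X Y
  act_one : ∀ {X Y : Obj} (f : Hom X Y), act X Y 1 f = f
  act_mul : ∀ {X Y : Obj} (a b : H) (f : Hom X Y),
      act X Y (a * b) f = act X Y a (act X Y b f)
  act_id : ∀ (X : Obj) (h : H), act X X h (id X) = Coalgebra.counit (R := k) h • id X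
  act_comp : ∀ {X Y Z : Obj} (h : H) (g : Hom Y Z) (f : Hom X Y)
      {ι : Type} (s : Finset ι) (a b : ι → H),
      Coalgebra.comul (R := k) h = ∑ i ∈ s, a i ⊗ₜ[k] b i →
      act X Z h (comp g f) = ∑ i ∈ s, comp (act Y Z (a i) g) (act X Y (b i) f)

attribute [instance] HCategory.homAddCommGroup HCategory.homModule

/-! ### Iterated comultiplication and Sweedler representations -/

/-- `H^{⊗(n+1)}` as iterated binary tensor products, bundled as a module. -/
def TPow : ℕ → ModuleCat.{0} k
  | 0 => ModuleCat.of k H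
  | n + 1 => ModuleCat.of k (H ⊗[k] (TPow n))

/-- The pure tensor `c 0 ⊗ c 1 ⊗ ⋯ ⊗ c n` in `H^{⊗(n+1)}`. -/
def chainT : (n : ℕ) → (Fin (n + 1) → H) → TPow k H n
  | 0, c => (c 0 : H)
  | n + 1, c => show H ⊗[k] (TPow k H n) from (c 0) ⊗ₜ[k] (chainT n fun j => c j.succ)

/-- The iterated comultiplication `Δⁿ : H → H^{⊗(n+1)}`. -/
def comulIter : (n : ℕ) → (H →ₗ[k] TPow k H n)
  | 0 => LinearMap.id
  | n + 1 => show H →ₗ[k] (H ⊗[k] (TPow k H n)) from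
      (LinearMap.lTensor H (comulIter n)) ∘ₗ (Coalgebra.comul (R := k))

/-- `∑ᵢ c i 0 ⊗ ⋯ ⊗ c i n` is a finite representation of `Δⁿ h` by pure tensors;
in Sweedler notation, `c i j` plays the role of `h_{j+1}`. -/
def IsComulRep (n : ℕ) (h : H) {ι : Type} (s : Finset ι) (c : ι → Fin (n + 1) → H) : Prop :=
  comulIter k H n h = ∑ i ∈ s, chainT k H n (c i)

/-! ### group-likes and the twisted antipode -/

variable {k H}

/-- `σ` is a group-like element. -/
def IsGroupLike (σ : H) : Prop :=
  Coalgebra.comul (R := k) σ = σ ⊗ₜ[k] σ ∧ Coalgebra.counit (R := k) σ = 1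

/-- The `δ`-twisted antipode `S_δ(h) = δ(h₁) S(h₂)`. -/
def twistedAntipode (δ : H →ₐ[k] k) : H →ₗ[k] H :=
  (TensorProduct.lid k H).toLinearMap
    ∘ₗ TensorProduct.map δ.toLinearMap (HopfAlgebra.antipode (R := k))
    ∘ₗ Coalgebra.comul (R := k)


/-! ### The cyclic nerve -/

/-- The cyclic nerve `CN_n(C) = ⊕ Hom(X₁,X₀) ⊗ ⋯ ⊗ Hom(X₀,X_n)`, the sum being indexed by
all `(n+1)`-tuples of objects; a tuple is a function `X : Fin (n+1) → Obj` and the `i`-th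
tensor factor is `Hom(X (i+1), X i)` (with cyclic indexing in `Fin (n+1)`). -/
abbrev CN (C : HCategory k H) (n : ℕ) : Type :=
  DirectSum (Fin (n + 1) → C.Obj) fun X => ⨂[k] (i : Fin (n + 1)), C.Hom (X (i + 1)) (X i)

/-- The generator `f⁰ ⊗ f¹ ⊗ ⋯ ⊗ fⁿ` of `CN_n(C)` sitting over the tuple of objects `X`. -/
def chainOf (C : HCategory k H) (n : ℕ) (X : Fin (n + 1) → C.Obj)
    (f : ∀ i : Fin (n + 1), C.Hom (X (i + 1)) (X i)) : CN C n := by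
  classical
  exact DirectSum.of (fun X : Fin (n + 1) → C.Obj =>
    ⨂[k] (i : Fin (n + 1)), C.Hom (X (i + 1)) (X i)) X (PiTensorProduct.tprod k f)

/-- A `σ`-trace on a left `H`-category: `T_X(g ∘ f) = T_Y(f ∘ (σ • g))`. -/
def IsSigmaTrace (C : HCategory k H) (σ : H)
    (T : ∀ X : C.Obj, C.Hom X X →ₗ[k] k) : Prop :=
  ∀ (X Y : C.Obj) (f : C.Hom X Y) (g : C.Hom Y X),
    T X (C.comp g f) = T Y (C.comp f (C.act Y X σ g))

/-- `δ`-invariance of a trace: `T_X(h • f) = δ(h) T_X(f)`. -/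
def IsDeltaInvariant (C : HCategory k H) (δ : H →ₐ[k] k)
    (T : ∀ X : C.Obj, C.Hom X X →ₗ[k] k) : Prop :=
  ∀ (X : C.Obj) (h : H) (f : C.Hom X X), T X (C.act X X h f) = δ h * T X f

/-- The generator `f` of `CN_0(C)` concentrated at a single object `X`. -/
def chain0 (C : HCategory k H) (X : C.Obj) (f : C.Hom X X) : CN C 0 :=
  chainOf C 0 (fun _ => X) (fun _ => f)

section S7

variable (C : HCategory k H) (δ : H →ₐ[k] k) (σ : H)

/-- `H`-equivariance of a `0`-cochain with coefficients in the SAYD module `^σk_δ`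
(whose right action is `α·h = δ(h)α` and left coaction is `α ↦ σ ⊗ α`):
`φ((α ⊗ f)·h) = ε(h)·φ(α ⊗ f)`, where `(α ⊗ f)·h = α δ(h₁) ⊗ S(h₂)•f`. -/
def Equivariant0 (φ : k ⊗[k] CN C 0 →ₗ[k] k) : Prop :=
  ∀ (α : k) (X : C.Obj) (f : C.Hom X X) (h : H) {ι : Type} (s : Finset ι) (a b : ι → H),
    Coalgebra.comul (R := k) h = ∑ i ∈ s, a i ⊗ₜ[k] b i →
    ∑ i ∈ s, φ ((α * δ (a i)) ⊗ₜ[k]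
        chain0 C X (C.act X X (HopfAlgebra.antipode (R := k) (b i)) f))
      = Coalgebra.counit (R := k) h * φ (α ⊗ₜ[k] chain0 C X f)

/-- The `0`-cocycle condition `δ₀(φ) = δ₁(φ)` for coefficients in `^σk_δ` : since the coaction
of `α` is exactly `σ ⊗ α`, this reads `φ(α ⊗ g∘f) = φ(α ⊗ (S⁻¹(σ)•f)∘g)`. -/
def Cocycle0 (Sinv : H →ₗ[k] H) (φ : k ⊗[k] CN C 0 →ₗ[k] k) : Prop :=
  ∀ (α : k) (X₀ X₁ : C.Obj) (g : C.Hom X₁ X₀) (f : C.Hom X₀ X₁),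
    φ (α ⊗ₜ[k] chain0 C X₀ (C.comp g f))
      = φ (α ⊗ₜ[k] chain0 C X₁ (C.comp (C.act X₀ X₁ (Sinv σ) f) g))

end S7

open Coalgebra HopfAlgebra in
theorem delta_inv_aux (δ : H →ₐ[k] k) (θ : H →ₗ[k] k)
    (h1 : ∀ (y h : H) {ι : Type} (s : Finset ι) (a b : ι → H),
      Coalgebra.comul (R := k) h = ∑ i ∈ s, a i ⊗ₜ[k] b i →
      ∑ i ∈ s, δ (a i) * θ (HopfAlgebra.antipode k (b i) * y)
        = Coalgebra.counit (R := k) h * θ y) (h : H) :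
    θ h = δ h * θ 1 := by
  have key := sum_tmul_tmul_eq (ℛ k h) (fun i => ℛ k ((ℛ k h).left i))
    (fun i => ℛ k ((ℛ k h).right i))
  let Φ : H ⊗[k] (H ⊗[k] H) →ₗ[k] k :=
    LinearMap.mul' k k ∘ₗ TensorProduct.map δ.toLinearMap
      (θ ∘ₗ LinearMap.mul' k H ∘ₗ TensorProduct.map (antipode k) LinearMap.id)
  have hΦ : ∀ a b c : H, Φ (a ⊗ₜ (b ⊗ₜ c)) = δ a * θ (antipode k b * c) := by
    intro a b c; simp [Φ]
  have key2 := congrArg Φ key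
  simp only [map_sum, hΦ] at key2
  have e1 : ∀ i, ∑ j ∈ (ℛ k ((ℛ k h).left i)).index,
      δ ((ℛ k ((ℛ k h).left i)).left j) *
        θ (antipode k ((ℛ k ((ℛ k h).left i)).right j) * (ℛ k h).right i)
      = counit (R := k) ((ℛ k h).left i) * θ ((ℛ k h).right i) := by
    intro i
    have := (ℛ k ((ℛ k h).left i)).eq
    exact h1 _ _ _ _ _ this.symm
  have e2 : ∀ i, ∑ j ∈ (ℛ k ((ℛ k h).right i)).index,
      δ ((ℛ k h).left i) *
        θ (antipode k ((ℛ k ((ℛ k h).right i)).left j) * (ℛ k ((ℛ k h).right i)).right j)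
      = δ ((ℛ k h).left i) * (counit (R := k) ((ℛ k h).right i) * θ 1) := by
    intro i
    rw [← Finset.mul_sum, ← map_sum, sum_antipode_mul_eq_smul, map_smul, smul_eq_mul]
  simp only [e1, e2] at key2
  have l : ∑ i ∈ (ℛ k h).index, counit (R := k) ((ℛ k h).left i) * θ ((ℛ k h).right i) = θ h := by
    conv_rhs => rw [← sum_counit_smul (ℛ k h)]
    simp
  have r : ∑ i ∈ (ℛ k h).index, δ ((ℛ k h).left i) * (counit (R := k) ((ℛ k h).right i) * θ 1)
      = δ h * θ 1 := by
    have := congrArg (LinearMap.mul' k k) (sum_map_tmul_counit_eq (R := k) δ h (repr := ℛ k h))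
    simp only [map_sum, LinearMap.mul'_apply, mul_one] at this
    rw [← this, Finset.sum_mul]
    simp only [mul_assoc]
  rw [← l, ← r, key2]

/-- `chain0` as a linear map. -/
def chain0L (C : HCategory k H) (X : C.Obj) : C.Hom X X →ₗ[k] CN C 0 := by
  classical
  exact (DirectSum.lof k (Fin (0 + 1) → C.Obj) (fun X : Fin (0 + 1) → C.Obj =>
    ⨂[k] (i : Fin (0 + 1)), C.Hom (X (i + 1)) (X i)) (fun _ => X)) ∘ₗ
    { toFun := fun f => PiTensorProduct.tprod k (fun _ : Fin 1 => f)
      map_add' := fun f g => by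
        have := (PiTensorProduct.tprod k (s := fun _ : Fin 1 => C.Hom X X)).map_update_add
          (fun _ => f) 0 f g
        have e : ∀ u : C.Hom X X, Function.update (fun _ : Fin 1 => f) 0 u = fun _ => u := by
          intro u; funext i; rw [Subsingleton.elim i 0]; simp
        simpa only [e] using this
      map_smul' := fun c f => by
        have := (PiTensorProduct.tprod k (s := fun _ : Fin 1 => C.Hom X X)).map_update_smul
          (fun _ => f) 0 c f
        have e : ∀ u : C.Hom X X, Function.update (fun _ : Fin 1 => f) 0 u = fun _ => u := by
          intro u; funext i; rw [Subsingleton.elim i 0]; simp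
        simp only [e] at this
        exact this }

theorem chain0L_apply (C : HCategory k H) (X : C.Obj) (f : C.Hom X X) :
    chain0L C X f = chain0 C X f := rfl

/-- `f ↦ T (f 0)`. -/
def traceMulti (C : HCategory k H) (T : ∀ X : C.Obj, C.Hom X X →ₗ[k] k)
    (X : Fin (0 + 1) → C.Obj) :
    MultilinearMap k (fun i : Fin (0 + 1) => C.Hom (X (i + 1)) (X i)) k where
  toFun f := T (X 0) (f 0)
  map_update_add' := by
    intro inst m i x y
    obtain rfl : i = 0 := Subsingleton.elim (α := Fin 1) i 0
    have e : ∀ u, Function.update m 0 u 0 = u := fun u => by simp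
    rw [e, e, e]
    exact map_add (T (X 0)) x y
  map_update_smul' := by
    intro inst m i c x
    obtain rfl : i = 0 := Subsingleton.elim (α := Fin 1) i 0
    have e : ∀ u, Function.update m 0 u 0 = u := fun u => by simp
    rw [e, e]
    exact map_smul (T (X 0)) c x

/-- The cochain of a trace. -/
def traceCochain (C : HCategory k H) (T : ∀ X : C.Obj, C.Hom X X →ₗ[k] k) :
    k ⊗[k] CN C 0 →ₗ[k] k := by
  classical
  exact (DirectSum.toModule k (Fin (0 + 1) → C.Obj) k
    (fun X => PiTensorProduct.lift (traceMulti C T X))) ∘ₗ (TensorProduct.lid k _).toLinearMap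

theorem traceCochain_apply (C : HCategory k H) (T : ∀ X : C.Obj, C.Hom X X →ₗ[k] k)
    (α : k) (X : C.Obj) (f : C.Hom X X) :
    traceCochain C T (α ⊗ₜ chain0 C X f) = α * T X f := by
  classical
  rw [traceCochain, LinearMap.comp_apply, LinearEquiv.coe_coe, TensorProduct.lid_tmul, map_smul,
    smul_eq_mul]
  congr 1
  unfold chain0 chainOf
  refine (DirectSum.toModule_lof k (M := fun X : Fin (0 + 1) → C.Obj =>
    ⨂[k] (i : Fin (0 + 1)), C.Hom (X (i + 1)) (X i)) (fun _ : Fin (0+1) => X) _).trans ?_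
  refine (PiTensorProduct.lift.tprod _).trans ?_
  rfl

theorem cochain_ext (C : HCategory k H) (φ ψ : k ⊗[k] CN C 0 →ₗ[k] k)
    (h : ∀ (X : C.Obj) (f : C.Hom X X), φ ((1 : k) ⊗ₜ[k] chain0 C X f)
      = ψ ((1 : k) ⊗ₜ[k] chain0 C X f)) : φ = ψ := by
  classical
  apply TensorProduct.ext
  apply LinearMap.ext_ring
  apply DirectSum.linearMap_ext
  intro X
  apply PiTensorProduct.ext
  ext f
  obtain ⟨x, rfl⟩ : ∃ x, X = fun _ => x :=
    ⟨X 0, funext fun i => by rw [Subsingleton.elim (α := Fin 1) i 0]⟩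
  obtain ⟨g, rfl⟩ : ∃ g : C.Hom x x, f = fun _ => g :=
    ⟨f 0, funext fun i => by
      obtain rfl : i = 0 := Subsingleton.elim (α := Fin 1) i 0
      rfl⟩
  exact h x g

theorem tmul_eq_mul (C : HCategory k H) (φ : k ⊗[k] CN C 0 →ₗ[k] k) (α : k) (x : CN C 0) :
    φ (α ⊗ₜ x) = α * φ ((1 : k) ⊗ₜ x) := by
  rw [← smul_eq_mul, ← map_smul, TensorProduct.smul_tmul', smul_eq_mul, mul_one]

/-- Let `(δ,σ)` be a modular pair in involution on `H` and `C` a left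
`H`-category.  The assignment `φ ↦ T^φ`, `T^φ_X(f) = φ(1 ⊗ f)`, is a bijection from
`Z⁰_H(C, ^σk_δ)` onto the set of `δ`-invariant `σ`-traces on `C`:  every `0`-cocycle induces a
`δ`-invariant `σ`-trace, and every `δ`-invariant `σ`-trace arises from a unique `0`-cocycle. -/
theorem statement7
    (Sinv : H →ₗ[k] H)
    (hSinv₁ : ∀ h : H, HopfAlgebra.antipode (R := k) (Sinv h) = h)
    (hSinv₂ : ∀ h : H, Sinv (HopfAlgebra.antipode (R := k) h) = h)
    (δ : H →ₐ[k] k) (σ : H) (hσ : IsGroupLike (k := k) σ) (hδσ : δ σ = 1)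
    (σinv : H) (hσinv₁ : σ * σinv = 1) (hσinv₂ : σinv * σ = 1)
    (hMPI : ∀ h : H, twistedAntipode δ (twistedAntipode δ h) = σ * h * σinv)
    (C : HCategory k H) :
    -- the map `φ ↦ T^φ` lands in `δ`-invariant `σ`-traces
    (∀ φ : k ⊗[k] CN C 0 →ₗ[k] k, Equivariant0 C δ φ → Cocycle0 C σ Sinv φ →
      ((∀ (X Y : C.Obj) (f : C.Hom X Y) (g : C.Hom Y X),
          φ ((1 : k) ⊗ₜ[k] chain0 C X (C.comp g f))
            = φ ((1 : k) ⊗ₜ[k] chain0 C Y (C.comp f (C.act Y X σ g)))) ∧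
        (∀ (X : C.Obj) (h : H) (f : C.Hom X X),
          φ ((1 : k) ⊗ₜ[k] chain0 C X (C.act X X h f))
            = δ h * φ ((1 : k) ⊗ₜ[k] chain0 C X f)))) ∧
    -- and is a bijection onto them
    (∀ T : (∀ X : C.Obj, C.Hom X X →ₗ[k] k),
      IsSigmaTrace C σ T → IsDeltaInvariant C δ T →
      ∃! φ : {ψ : k ⊗[k] CN C 0 →ₗ[k] k // Equivariant0 C δ ψ ∧ Cocycle0 C σ Sinv ψ},
        ∀ (X : C.Obj) (f : C.Hom X X), φ.1 ((1 : k) ⊗ₜ[k] chain0 C X f) = T X f) := by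
  have hg : IsGroupLikeElem k σ := ⟨hσ.2, hσ.1⟩
  have hS : HopfAlgebra.antipode k σ = σinv :=
    left_inv_eq_right_inv hg.antipode_mul_cancel hσinv₁
  have hinv : Sinv σ = σinv := by
    have := hSinv₂ σinv
    rwa [← hS, hg.antipode_antipode, hS] at this
  have hcomp : ∀ (X Y Z : C.Obj) (g : C.Hom Y Z) (f : C.Hom X Y),
      C.act X Z σ (C.comp g f) = C.comp (C.act Y Z σ g) (C.act X Y σ f) := by
    intro X Y Z g f
    simpa using C.act_comp σ g f (Finset.univ : Finset Unit) (fun _ => σ) (fun _ => σ)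
      (by simpa using hσ.1)
  have hkey : ∀ (X Y : C.Obj) (f : C.Hom X Y) (g : C.Hom Y X),
      C.act Y Y σ (C.comp (C.act X Y (Sinv σ) f) g) = C.comp f (C.act Y X σ g) := by
    intro X Y f g
    rw [hcomp, hinv, ← C.act_mul, hσinv₁, C.act_one]
  refine ⟨?_, ?_⟩
  · intro φ hE hC
    have hinvar : ∀ (X : C.Obj) (h : H) (f : C.Hom X X),
          φ ((1 : k) ⊗ₜ[k] chain0 C X (C.act X X h f))
            = δ h * φ ((1 : k) ⊗ₜ[k] chain0 C X f) := by
      intro X h f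
      let θ : H →ₗ[k] k := φ ∘ₗ (TensorProduct.mk k k (CN C 0) 1) ∘ₗ chain0L C X ∘ₗ
        (C.act X X).flip f
      have hθ : ∀ x, θ x = φ ((1 : k) ⊗ₜ[k] chain0 C X (C.act X X x f)) := fun x => rfl
      have := delta_inv_aux δ θ (by
        intro y h ι s a b hab
        have := hE 1 X (C.act X X y f) h s a b hab
        simp only [hθ, C.act_mul]
        rw [← this]
        refine Finset.sum_congr rfl fun i _ => ?_
        rw [tmul_eq_mul C φ (1 * _), one_mul]) h
      rw [hθ, hθ, C.act_one] at this
      exact this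
    refine ⟨?_, hinvar⟩
    intro X Y f g
    rw [hC 1 X Y g f, ← hkey, hinvar, hδσ, one_mul]
  · intro T hT hI
    refine ⟨⟨traceCochain C T, ?_, ?_⟩, ?_, ?_⟩
    · intro α X f h ι s a b hab
      simp only [traceCochain_apply]
      have := HopfAlgebra.sum_mul_antipode_eq_smul (R := k) (a := h) ⟨s, a, b, hab.symm⟩
      have := congrArg δ this
      simp only [map_sum, map_mul, map_smul, map_one, smul_eq_mul, mul_one] at this
      rw [← this, Finset.sum_mul]
      refine Finset.sum_congr rfl fun i _ => ?_
      rw [hI]; ring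
    · intro α X Y g f
      simp only [traceCochain_apply]
      rw [hT, ← hkey, hI, hδσ, one_mul]
    · intro X f
      simp [traceCochain_apply]
    · rintro ⟨ψ, h1, h2⟩ h
      apply Subtype.ext
      apply cochain_ext
      intro X f
      rw [traceCochain_apply, one_mul]
      exact h X f


end HopfCyclicStmt
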